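/- arXiv:0912.2190 — 2 statements merged into one kernel-verified Lean document; each statement's English description precedes it below -/
import Mathlib

section
/- (Rank-like decomposition) Let v be a complete Llull matrix on a finite set A of N elements and let A = X ∪ Y be a partition into two disjoint nonempty sets. Let R denote the rank-like rates of v, and let R̃ denote the rank-like rates computed from the restriction of v to X (respectively to Y), using |X| (respectively |Y|) in place of N. Then the following four conditions are equivalent: (i) v_{xy} = 1 for all x ∈ X and y ∈ Y; (ii) R_x = R̃_x for all x ∈ X; (iii) R_y = R̃_y + |X| for all y ∈ Y; (iv) Σ_{x ∈ X} R_x = |X|(|X|+1)/2. -/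
/-! Common definitions: valued relations, indirect scores, admissible orders,
projected margins/scores, rank-like rates (Camps–Mora–Saumell CLC method). -/

variable {A : Type*} [Fintype A] [DecidableEq A]

/-- The score of a chain `x₀ :: x₁ :: ... :: xₙ`: the minimum of `v xᵢ xᵢ₊₁`
over its links (value `1` for chains with no link, which we never use). -/
noncomputable def linkScore (v : A → A → ℝ) : List A → ℝ
  | [] => 1
  | [_] => 1
  | [a, b] => v a b
  | a :: b :: c :: l => min (v a b) (linkScore v (b :: c :: l))

/-- The indirect score `v*_{xy}`: the supremum (= maximum) of the scores of all
paths from `x` to `y` (with at least one link, consecutive elements distinct). -/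
noncomputable def istar (v : A → A → ℝ) (x y : A) : ℝ :=
  sSup { s : ℝ | ∃ l : List A, List.Chain' (· ≠ ·) (x :: (l ++ [y])) ∧
      s = linkScore v (x :: (l ++ [y])) }

/-- `ξ` is a strict total order: irreflexive, transitive, total. -/
def StrictTotal (ξ : A → A → Prop) : Prop :=
  (∀ x, ¬ ξ x x) ∧ (∀ x y z, ξ x y → ξ y z → ξ x z) ∧ (∀ x y, x ≠ y → ξ x y ∨ ξ y x)

/-- `ξ` is admissible for `v`: `v*_{xy} > v*_{yx}` implies `x` precedes `y`. -/
def Adm (v : A → A → ℝ) (ξ : A → A → Prop) : Prop :=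
  ∀ x y, istar v x y > istar v y x → ξ x y

/-- Intermediate projected margin `m^σ_{xy}` (for `x` preceding `y` in `ξ`):
the infimum (= minimum) of the indirect margins `m*_{pq}` over `p ⪯ x`, `y ⪯ q`. -/
noncomputable def msigma (v : A → A → ℝ) (ξ : A → A → Prop) (x y : A) : ℝ :=
  sInf { s : ℝ | ∃ p q, (ξ p x ∨ p = x) ∧ (ξ y q ∨ q = y) ∧
      s = istar v p q - istar v q p }

/-- `q` is the immediate successor of `p` in `ξ`. -/
def ImmSucc (ξ : A → A → Prop) (p q : A) : Prop :=
  ξ p q ∧ ∀ z, ¬ (ξ p z ∧ ξ z q)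

/-- Projected margin (for `x` preceding `y` in `ξ`): the supremum (= maximum) of
`m^σ_{p p'}` over `x ⪯ p ≺ y`, `p'` the immediate successor of `p`. -/
noncomputable def mpiAux (v : A → A → ℝ) (ξ : A → A → Prop) (x y : A) : ℝ :=
  sSup { s : ℝ | ∃ p q, (ξ x p ∨ p = x) ∧ ξ p y ∧ ImmSucc ξ p q ∧
      s = msigma v ξ p q }

open Classical in
/-- Projected margins `m^π`, extended antisymmetrically. -/
noncomputable def mpi (v : A → A → ℝ) (ξ : A → A → Prop) (x y : A) : ℝ :=
  if ξ x y then mpiAux v ξ x y else - mpiAux v ξ y x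

/-- Projected scores `v^π_{xy} = (1 + m^π_{xy})/2`. -/
noncomputable def vpi (v : A → A → ℝ) (ξ : A → A → Prop) (x y : A) : ℝ :=
  (1 + mpi v ξ x y) / 2

/-- Rank-like rate `R_x = N - ∑_{y ≠ x} v^π_{xy}`. -/
noncomputable def rlr (v : A → A → ℝ) (ξ : A → A → Prop) (x : A) : ℝ :=
  (Fintype.card A : ℝ) - ∑ y ∈ Finset.univ.erase x, vpi v ξ x y

/-- `v` is a complete Llull matrix: scores of distinct pairs lie in `[0,1]`
and satisfy `v_{xy} + v_{yx} = 1`. -/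
def Llull (v : A → A → ℝ) : Prop :=
  ∀ x y : A, x ≠ y → 0 ≤ v x y ∧ v x y ≤ 1 ∧ v x y + v y x = 1

theorem linkScore_mem_Icc {A : Type*} {v : A → A → ℝ}
    (hv : ∀ x y : A, x ≠ y → 0 ≤ v x y ∧ v x y ≤ 1) :
    ∀ l : List A, l.IsChain (· ≠ ·) → linkScore v l ∈ Set.Icc 0 1
  | [], _ => by simp [linkScore]
  | [_], _ => by simp [linkScore]
  | [a, b], h => by
    rw [List.isChain_cons_cons] at h
    exact hv a b h.1
  | a :: b :: c :: l, h => by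
    rw [List.isChain_cons_cons] at h
    have h₁ := linkScore_mem_Icc hv (b :: c :: l) h.2
    have h₂ := hv a b h.1
    exact ⟨le_min h₂.1 h₁.1, (min_le_left _ _).trans h₂.2⟩

theorem isChain_pos_of_linkScore_pos {A : Type*} {v : A → A → ℝ} :
    ∀ l : List A, 0 < linkScore v l → l.IsChain (fun a b => 0 < v a b)
  | [], _ => by simp
  | [_], _ => by simp
  | [a, b], h => by simpa [linkScore] using h
  | a :: b :: c :: l, h => by
    rw [linkScore, lt_min_iff] at h
    exact List.isChain_cons_cons.2 ⟨h.1, isChain_pos_of_linkScore_pos _ h.2⟩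

theorem linkScore_map {A B : Type*} (v : A → A → ℝ) (f : B → A) :
    ∀ l : List B, linkScore v (l.map f) = linkScore (fun a b => v (f a) (f b)) l
  | [] => rfl
  | [_] => rfl
  | [_, _] => rfl
  | a :: b :: c :: l => by
    have h := linkScore_map v f (b :: c :: l)
    simp only [List.map_cons] at h ⊢
    rw [linkScore, linkScore, h]

theorem forall_mem_of_isChain_cons {A : Type*} {r : A → A → Prop} {T : Set A}
    (hT : ∀ a b, r a b → a ∈ T → b ∈ T) :
    ∀ (x : A) (l : List A), (x :: l).IsChain r → x ∈ T → ∀ z ∈ x :: l, z ∈ T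
  | x, [], _, hx, z, hz => by simp_all
  | x, b :: l, h, hx, z, hz => by
    rw [List.isChain_cons_cons] at h
    rcases List.mem_cons.1 hz with rfl | hz
    · exact hx
    · exact forall_mem_of_isChain_cons hT b l h.2 (hT _ _ h.1 hx) z hz

section Indirect

variable {A : Type*} {v : A → A → ℝ}

theorem Llull.bounds (hv : Llull v) (x y : A) (h : x ≠ y) : 0 ≤ v x y ∧ v x y ≤ 1 :=
  ⟨(hv x y h).1, (hv x y h).2.1⟩

theorem istar_mem_Icc (hv : Llull v) (x y : A) : istar v x y ∈ Set.Icc 0 1 := by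
  constructor
  · refine Real.sSup_nonneg ?_
    rintro s ⟨l, hl, rfl⟩
    exact (linkScore_mem_Icc hv.bounds _ hl).1
  · refine Real.sSup_le ?_ zero_le_one
    rintro s ⟨l, hl, rfl⟩
    exact (linkScore_mem_Icc hv.bounds _ hl).2

theorem linkScore_le_istar (hv : Llull v) {x y : A} (l : List A)
    (hl : (x :: (l ++ [y])).IsChain (· ≠ ·)) :
    linkScore v (x :: (l ++ [y])) ≤ istar v x y := by
  refine le_csSup ⟨1, ?_⟩ ⟨l, hl, rfl⟩
  rintro s ⟨l, hl, rfl⟩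
  exact (linkScore_mem_Icc hv.bounds _ hl).2

theorem le_istar (hv : Llull v) {x y : A} (h : x ≠ y) : v x y ≤ istar v x y := by
  simpa [linkScore] using linkScore_le_istar hv (x := x) (y := y) [] (by simpa using h)

theorem margin_le_one (hv : Llull v) (x y : A) : istar v x y - istar v y x ≤ 1 := by
  linarith [(istar_mem_Icc hv x y).2, (istar_mem_Icc hv y x).1]

variable {T : Set A}

theorem eq_zero_of_cut (hv : Llull v) (hT : ∀ a ∈ T, ∀ b ∉ T, v a b = 1)
    {a b : A} (ha : a ∈ T) (hb : b ∉ T) : v b a = 0 := by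
  have hab : a ≠ b := by rintro rfl; exact hb ha
  linarith [(hv a b hab).2.2, hT a ha b hb]

theorem compl_closed_of_cut (hv : Llull v) (hT : ∀ a ∈ T, ∀ b ∉ T, v a b = 1)
    (a b : A) (h : 0 < v a b) (ha : a ∈ Tᶜ) : b ∈ Tᶜ := by
  intro hb
  exact h.ne' (eq_zero_of_cut hv hT hb ha)

theorem margin_of_cut (hv : Llull v) (hT : ∀ a ∈ T, ∀ b ∉ T, v a b = 1)
    {a b : A} (ha : a ∈ T) (hb : b ∉ T) : istar v a b - istar v b a = 1 := by
  have hab : a ≠ b := by rintro rfl; exact hb ha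
  have h₁ : 1 ≤ istar v a b := hT a ha b hb ▸ le_istar hv hab
  have h₂ : istar v b a ≤ 0 := by
    refine Real.sSup_le ?_ le_rfl
    rintro s ⟨l, -, rfl⟩
    by_contra! h
    exact forall_mem_of_isChain_cons (compl_closed_of_cut hv hT) _ _
      (isChain_pos_of_linkScore_pos _ h) hb a (by simp) ha
  linarith [margin_le_one hv a b]

theorem forall_mem_of_linkScore_pos (hv : Llull v) (hT : ∀ a ∈ T, ∀ b ∉ T, v a b = 1)
    {S : Set A} (hS : S = T ∨ S = Tᶜ) {x y : A} (hx : x ∈ S) (hy : y ∈ S) (l : List A)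
    (h : 0 < linkScore v (x :: (l ++ [y]))) : ∀ z ∈ l, z ∈ S := by
  have hc := isChain_pos_of_linkScore_pos _ h
  intro z hz
  rcases hS with rfl | rfl
  · have hr : (y :: (l.reverse ++ [x])).IsChain (fun a b => 0 < v b a) := by
      simpa only [List.reverse_cons, List.reverse_append, List.reverse_nil, List.nil_append,
        List.singleton_append, List.cons_append] using
        (List.isChain_reverse (l := x :: (l ++ [y]))).2 hc
    refine forall_mem_of_isChain_cons (T := S) (fun a b hab ha => ?_) _ _ hr hy z (by simp [hz])
    by_contra hb
    exact compl_closed_of_cut hv hT b a hab hb ha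
  · exact forall_mem_of_isChain_cons (compl_closed_of_cut hv hT) _ _ hc hx z (by simp [hz])

theorem Llull.restrict (hv : Llull v) (S : Finset A) :
    Llull (fun a b : ↥S => v a b) :=
  fun x y h => hv x y (Subtype.coe_injective.ne h)

theorem istar_restrict (hv : Llull v) (hT : ∀ a ∈ T, ∀ b ∉ T, v a b = 1)
    {S : Finset A} (hS : (S : Set A) = T ∨ (S : Set A) = Tᶜ) (x y : ↥S) :
    istar (fun a b : ↥S => v a b) x y = istar v x y := by
  have hw := hv.restrict S
  have key (l : List ↥S) : (x : A) :: (l.map Subtype.val ++ [(y : A)]) =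
      (x :: (l ++ [y])).map Subtype.val := by simp
  apply le_antisymm
  · refine Real.sSup_le ?_ (istar_mem_Icc hv _ _).1
    rintro s ⟨l, hl, rfl⟩
    rw [← linkScore_map v Subtype.val, ← key]
    refine linkScore_le_istar hv _ ?_
    rw [key, List.isChain_map]
    exact hl.imp fun a b h => Subtype.coe_injective.ne h
  · refine Real.sSup_le ?_ (istar_mem_Icc hw _ _).1
    rintro s ⟨l, hl, rfl⟩
    by_cases h : 0 < linkScore v ((x : A) :: (l ++ [(y : A)]))
    · have hm : ∀ z ∈ l, z ∈ S := forall_mem_of_linkScore_pos hv hT hS x.2 y.2 l h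
      lift l to List ↥S using hm
      rw [key, linkScore_map]
      refine linkScore_le_istar hw _ ?_
      rw [key] at hl
      exact (List.isChain_map _).1 hl |>.imp fun a b h e => h (congrArg _ e)
    · exact (not_lt.1 h).trans (istar_mem_Icc hw _ _).1

end Indirect

section Projection

variable {A : Type*} {v : A → A → ℝ} {ξ : A → A → Prop}

theorem margin_nonneg (hξ : StrictTotal ξ) (hadm : Adm v ξ) {x y : A} (h : ξ x y) :
    0 ≤ istar v x y - istar v y x := by
  by_contra! hlt
  exact hξ.1 x (hξ.2.1 _ _ _ h (hadm y x (by linarith)))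

theorem msigma_nonneg (hξ : StrictTotal ξ) (hadm : Adm v ξ) {x y : A} (h : ξ x y) :
    0 ≤ msigma v ξ x y := by
  refine Real.sInf_nonneg ?_
  rintro s ⟨p, q, hp, hq, rfl⟩
  apply margin_nonneg hξ hadm
  have hpy : ξ p y := hp.elim (fun hp => hξ.2.1 _ _ _ hp h) (fun hp => hp ▸ h)
  exact hq.elim (fun hq => hξ.2.1 _ _ _ hpy hq) (fun hq => hq ▸ hpy)

theorem mpiAux_nonneg (hξ : StrictTotal ξ) (hadm : Adm v ξ) (x y : A) :
    0 ≤ mpiAux v ξ x y := by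
  refine Real.sSup_nonneg ?_
  rintro s ⟨p, q, -, -, hpq, rfl⟩
  exact msigma_nonneg hξ hadm hpq.1

theorem mpi_self (hξ : StrictTotal ξ) (x : A) : mpi v ξ x x = 0 := by
  have h : { s : ℝ | ∃ p q, (ξ x p ∨ p = x) ∧ ξ p x ∧ ImmSucc ξ p q ∧
      s = msigma v ξ p q } = ∅ := by
    refine Set.eq_empty_of_forall_notMem ?_
    rintro s ⟨p, q, hxp | rfl, hpx, -⟩
    · exact hξ.1 _ (hξ.2.1 _ _ _ hxp hpx)
    · exact hξ.1 _ hpx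
  rw [mpi, if_neg (hξ.1 x), mpiAux, h, Real.sSup_empty, neg_zero]

theorem mpi_antisymm (hξ : StrictTotal ξ) (x y : A) : mpi v ξ x y = - mpi v ξ y x := by
  rcases eq_or_ne x y with rfl | h
  · simp [mpi_self hξ]
  rcases hξ.2.2 x y h with h | h
  · rw [mpi, mpi, if_pos h, if_neg fun h' => hξ.1 _ (hξ.2.1 _ _ _ h h'), neg_neg]
  · rw [mpi, mpi, if_pos h, if_neg fun h' => hξ.1 _ (hξ.2.1 _ _ _ h h')]

/-- A characterization of the positive projected margins that does not involve
the order: a positive cut of `A` is an initial segment of every admissible order. -/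
theorem le_mpi_iff [Finite A] (hξ : StrictTotal ξ) (hadm : Adm v ξ) {t : ℝ} (ht : 0 < t)
    (x y : A) : t ≤ mpi v ξ x y ↔ ∃ I : Set A, x ∈ I ∧ y ∉ I ∧
      ∀ p ∈ I, ∀ q ∉ I, t ≤ istar v p q - istar v q p := by
  have hfin (P : A → A → Prop) (f : A → A → ℝ) :
      { s : ℝ | ∃ p q, P p q ∧ s = f p q }.Finite :=
    (Set.finite_range fun z : A × A => f z.1 z.2).subset <| by
      rintro s ⟨p, q, -, rfl⟩
      exact ⟨(p, q), rfl⟩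
  have hfinσ (p q : A) : { s : ℝ | ∃ p' q', (ξ p' p ∨ p' = p) ∧ (ξ q q' ∨ q' = q) ∧
      s = istar v p' q' - istar v q' p' }.Finite := by
    simpa only [and_assoc] using
      hfin (fun p' q' => (ξ p' p ∨ p' = p) ∧ (ξ q q' ∨ q' = q))
        (fun p' q' => istar v p' q' - istar v q' p')
  have hfinπ : { s : ℝ | ∃ p q, (ξ x p ∨ p = x) ∧ ξ p y ∧ ImmSucc ξ p q ∧
      s = msigma v ξ p q }.Finite := by
    simpa only [and_assoc] using
      hfin (fun p q => (ξ x p ∨ p = x) ∧ ξ p y ∧ ImmSucc ξ p q) (msigma v ξ)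
  constructor
  · intro h
    have hxy : ξ x y := by
      by_contra hxy
      rw [mpi, if_neg hxy] at h
      linarith [mpiAux_nonneg hξ hadm y x]
    rw [mpi, if_pos hxy, mpiAux] at h
    have hne : { s : ℝ | ∃ p q, (ξ x p ∨ p = x) ∧ ξ p y ∧ ImmSucc ξ p q ∧
        s = msigma v ξ p q }.Nonempty := by
      by_contra hne
      rw [Set.not_nonempty_iff_eq_empty.1 hne, Real.sSup_empty] at h
      linarith
    obtain ⟨p, q, hxp, hpy, hpq, hs⟩ := hne.csSup_mem hfinπ
    rw [hs] at h
    refine ⟨{z | ξ z p ∨ z = p}, hxp.imp_right Eq.symm, ?_, fun p' hp' q' hq' => h.trans ?_⟩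
    · rintro (hyp | rfl)
      · exact hξ.1 _ (hξ.2.1 _ _ _ hyp hpy)
      · exact hξ.1 _ hpy
    · refine csInf_le (hfinσ p q).bddBelow ⟨p', q', hp', ?_, rfl⟩
      simp only [Set.mem_ofPred_eq, not_or] at hq'
      have hpq' : ξ p q' := (hξ.2.2 _ _ hq'.2).resolve_left hq'.1
      by_contra! hcon
      exact hpq.2 q' ⟨hpq', (hξ.2.2 _ _ hcon.2).resolve_right hcon.1⟩
  · rintro ⟨I, hxI, hyI, hI⟩
    have hsep {p q : A} (hp : p ∈ I) (hq : q ∉ I) : ξ p q :=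
      hadm p q (by linarith [hI p hp q hq])
    have : IsTrans A ξ := ⟨hξ.2.1⟩
    have : Std.Irrefl ξ := ⟨hξ.1⟩
    obtain ⟨p, hp, hpmax⟩ :=
      (Finite.wellFounded_of_trans_of_irrefl (Function.swap ξ)).has_min I ⟨x, hxI⟩
    obtain ⟨q, hq, hqmin⟩ :=
      (Finite.wellFounded_of_trans_of_irrefl ξ).has_min Iᶜ ⟨y, hyI⟩
    rw [mpi, if_pos (hsep hxI hyI)]
    have hle : t ≤ msigma v ξ p q := by
      refine le_csInf ⟨_, p, q, Or.inr rfl, Or.inr rfl, rfl⟩ ?_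
      rintro s ⟨p', q', hp', hq', rfl⟩
      refine hI p' ?_ q' ?_
      · rcases hp' with hp' | rfl
        · by_contra hn
          exact hξ.1 _ (hξ.2.1 _ _ _ hp' (hsep hp hn))
        · exact hp
      · rcases hq' with hq' | rfl
        · intro hn
          exact hξ.1 _ (hξ.2.1 _ _ _ hq' (hsep hn hq))
        · exact hq
    refine hle.trans (le_csSup hfinπ.bddAbove ⟨p, q, ?_, hsep hp hyI, ⟨hsep hp hq, ?_⟩, rfl⟩)
    · by_contra! hcon
      exact hcon.1 ((hξ.2.2 _ _ hcon.2).resolve_left (hpmax x hxI))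
    · rintro z ⟨hpz, hzq⟩
      by_cases hz : z ∈ I
      · exact hpmax z hz hpz
      · exact hqmin z hz hzq

theorem mpi_le_margin [Finite A] (hξ : StrictTotal ξ) (hadm : Adm v ξ) {x y : A}
    (h : 0 < mpi v ξ x y) : mpi v ξ x y ≤ istar v x y - istar v y x := by
  obtain ⟨I, hx, hy, hI⟩ := (le_mpi_iff hξ hadm h x y).1 le_rfl
  exact hI x hx y hy

theorem mpi_le_one [Finite A] (hv : Llull v) (hξ : StrictTotal ξ) (hadm : Adm v ξ) (x y : A) :
    mpi v ξ x y ≤ 1 := by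
  by_contra! h
  linarith [mpi_le_margin hξ hadm (zero_lt_one.trans h), margin_le_one hv x y]

theorem mpi_of_cut [Finite A] (hv : Llull v) (hξ : StrictTotal ξ) (hadm : Adm v ξ) {T : Set A}
    (hT : ∀ a ∈ T, ∀ b ∉ T, v a b = 1) {a b : A} (ha : a ∈ T) (hb : b ∉ T) :
    mpi v ξ a b = 1 :=
  (mpi_le_one hv hξ hadm a b).antisymm <| (le_mpi_iff hξ hadm zero_lt_one a b).2
    ⟨T, ha, hb, fun _ hp _ hq => (margin_of_cut hv hT hp hq).ge⟩

theorem eq_of_forall_pos_le_iff {a b : ℝ} (h₁ : ∀ t, 0 < t → (t ≤ a ↔ t ≤ b))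
    (h₂ : ∀ t, 0 < t → (t ≤ -a ↔ t ≤ -b)) : a = b := by
  have aux {a b : ℝ} (h₁ : ∀ t, 0 < t → (t ≤ a ↔ t ≤ b))
      (h₂ : ∀ t, 0 < t → (t ≤ -a ↔ t ≤ -b)) : a ≤ b := by
    rcases lt_or_ge 0 a with ha | ha
    · exact (h₁ a ha).1 le_rfl
    · by_contra! hab
      linarith [(h₂ (-b) (by linarith)).2 le_rfl]
  exact (aux h₁ h₂).antisymm (aux (fun t ht => (h₁ t ht).symm) fun t ht => (h₂ t ht).symm)

theorem mpi_restrict [Finite A] (hv : Llull v) (hξ : StrictTotal ξ) (hadm : Adm v ξ) {T : Set A}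
    (hT : ∀ a ∈ T, ∀ b ∉ T, v a b = 1)
    {S : Finset A} (hS : (S : Set A) = T ∨ (S : Set A) = Tᶜ) {η : ↥S → ↥S → Prop}
    (hη : StrictTotal η) (hadmη : Adm (fun a b : ↥S => v a b) η) (x y : ↥S) :
    mpi v ξ x y = mpi (fun a b : ↥S => v a b) η x y := by
  have key (x y : ↥S) (t : ℝ) (ht : 0 < t) :
      t ≤ mpi v ξ x y ↔ t ≤ mpi (fun a b : ↥S => v a b) η x y := by
    rw [le_mpi_iff hξ hadm ht, le_mpi_iff hη hadmη ht]
    simp only [istar_restrict hv hT hS]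
    constructor
    · rintro ⟨I, hx, hy, hI⟩
      exact ⟨{z : ↥S | (z : A) ∈ I}, hx, hy, fun p hp q hq => hI p hp q hq⟩
    · rintro ⟨J, hx, hy, hJ⟩
      have ht1 : t ≤ 1 := (hJ x hx y hy).trans (margin_le_one hv _ _)
      have hcut {p q : A} (hp : p ∈ T) (hq : q ∉ T) : t ≤ istar v p q - istar v q p :=
        ht1.trans (margin_of_cut hv hT hp hq).ge
      have hmem (z : A) : z ∈ S ↔ z ∈ (S : Set A) := Iff.rfl
      rcases hS with hS | hS
      · refine ⟨{z | ∃ h : z ∈ S, (⟨z, h⟩ : ↥S) ∈ J}, ⟨x.2, hx⟩, fun ⟨_, h⟩ => hy h, ?_⟩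
        rintro p ⟨hpS, hp⟩ q hq
        by_cases hqS : q ∈ S
        · exact hJ ⟨p, hpS⟩ hp ⟨q, hqS⟩ fun h => hq ⟨hqS, h⟩
        · exact hcut (hS ▸ hpS) (hS ▸ hqS)
      · refine ⟨{z | ∀ h : z ∈ S, (⟨z, h⟩ : ↥S) ∈ J}, fun _ => hx, fun h => hy (h y.2), ?_⟩
        intro p hp q hq
        simp only [Set.mem_ofPred_eq, not_forall] at hq
        obtain ⟨hqS, hq⟩ := hq
        by_cases hpS : p ∈ S
        · exact hJ ⟨p, hpS⟩ (hp hpS) ⟨q, hqS⟩ hq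
        · rw [hmem, hS] at hpS hqS
          exact hcut (not_not.1 hpS) hqS
  refine eq_of_forall_pos_le_iff (key x y) fun t ht => ?_
  rw [← mpi_antisymm hξ, ← mpi_antisymm hη]
  exact key y x t ht

end Projection

section Rates

variable {A : Type*} {v : A → A → ℝ} {ξ : A → A → Prop}

theorem rlr_eq [Fintype A] [DecidableEq A] (hξ : StrictTotal ξ) (x : A) :
    rlr v ξ x = Fintype.card A + 1 / 2 - ∑ y, vpi v ξ x y := by
  rw [rlr, Finset.sum_erase_eq_sub (Finset.mem_univ x), vpi, mpi_self hξ]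
  ring

theorem sum_vpi (hξ : StrictTotal ξ) (S : Finset A) :
    ∑ x ∈ S, ∑ y ∈ S, vpi v ξ x y = (S.card : ℝ) ^ 2 / 2 := by
  have h₁ : ∑ x ∈ S, ∑ y ∈ S, vpi v ξ x y = ∑ x ∈ S, ∑ y ∈ S, vpi v ξ y x := Finset.sum_comm
  have h₂ : ∑ x ∈ S, ∑ y ∈ S, vpi v ξ x y + ∑ x ∈ S, ∑ y ∈ S, vpi v ξ y x
      = (S.card : ℝ) ^ 2 := by
    simp only [← Finset.sum_add_distrib]
    have (x y : A) : vpi v ξ x y + vpi v ξ y x = 1 := by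
      rw [vpi, vpi, mpi_antisymm hξ y x]
      ring
    simp [this, sq]
  linarith

theorem sum_rlr [Fintype A] [DecidableEq A] (hξ : StrictTotal ξ) :
    ∑ x, rlr v ξ x = (Fintype.card A : ℝ) * (Fintype.card A + 1) / 2 := by
  simp only [rlr_eq hξ, Finset.sum_sub_distrib, sum_vpi hξ, Finset.sum_const, Finset.card_univ,
    nsmul_eq_mul]
  ring

variable [Fintype A] [DecidableEq A] {X Y : Finset A}

theorem rlr_eq_of_partition (hξ : StrictTotal ξ) (hdisj : Disjoint X Y)
    (hcover : X ∪ Y = Finset.univ) (x : A) :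
    rlr v ξ x = X.card + Y.card + 1 / 2 - ∑ y ∈ X, vpi v ξ x y - ∑ y ∈ Y, vpi v ξ x y := by
  rw [rlr_eq hξ, ← hcover, Finset.sum_union hdisj, ← Finset.card_univ, ← hcover,
    Finset.card_union_of_disjoint hdisj]
  push_cast
  ring

theorem eq_one_of_sum_rlr (hv : Llull v) (hξ : StrictTotal ξ) (hadm : Adm v ξ)
    (hdisj : Disjoint X Y) (hcover : X ∪ Y = Finset.univ)
    (h : ∑ x ∈ X, rlr v ξ x = (X.card : ℝ) * (X.card + 1) / 2) :
    ∀ x ∈ X, ∀ y ∈ Y, v x y = 1 := by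
  have hle (x y : A) : vpi v ξ x y ≤ 1 := by
    rw [vpi]
    linarith [mpi_le_one hv hξ hadm x y]
  simp only [rlr_eq_of_partition hξ hdisj hcover, Finset.sum_sub_distrib, sum_vpi hξ,
    Finset.sum_const, nsmul_eq_mul] at h
  have hsum : ∑ z ∈ X ×ˢ Y, vpi v ξ z.1 z.2 = ∑ z ∈ X ×ˢ Y, (1 : ℝ) := by
    rw [Finset.sum_product, Finset.sum_const, Finset.card_product, nsmul_eq_mul]
    push_cast
    linarith
  have hone := (Finset.sum_eq_sum_iff_of_le fun z _ => hle z.1 z.2).1 hsum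
  intro x hx y hy
  have hxy : x ≠ y := fun e => Finset.disjoint_left.1 hdisj hx (e ▸ hy)
  have hvpi : vpi v ξ x y = 1 := hone (x, y) (Finset.mk_mem_product hx hy)
  have hm : mpi v ξ x y = 1 := by
    rw [vpi] at hvpi
    linarith
  have hmargin := mpi_le_margin hξ hadm (x := x) (y := y) (by rw [hm]; exact one_pos)
  linarith [(istar_mem_Icc hv x y).2, le_istar hv hxy.symm, hv x y hxy, (hv x y hxy).2.1,
    (hv x y hxy).2.2]

theorem rlr_restrict_eq (hv : Llull v) (hξ : StrictTotal ξ) (hadm : Adm v ξ) {T : Set A}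
    (hT : ∀ a ∈ T, ∀ b ∉ T, v a b = 1)
    {S : Finset A} (hS : (S : Set A) = T ∨ (S : Set A) = Tᶜ) {η : ↥S → ↥S → Prop}
    (hη : StrictTotal η) (hadmη : Adm (fun a b : ↥S => v a b) η) (x : ↥S) :
    rlr (fun a b : ↥S => v a b) η x = S.card + 1 / 2 - ∑ y ∈ S, vpi v ξ x y := by
  rw [rlr_eq hη, Fintype.card_coe, ← Finset.sum_coe_sort S]
  simp only [vpi, mpi_restrict hv hξ hadm hT hS hη hadmη]

end Rates

/-- Rank-like decomposition: For a partition `A = X ∪ Y` into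
disjoint nonempty sets, with `R` the rank-like rates of `v` and `R̃` those of
the restrictions of `v` to `X` and to `Y`, the following are equivalent:
(i) `v_{xy} = 1` for all `x ∈ X`, `y ∈ Y`; (ii) `R_x = R̃_x` on `X`;
(iii) `R_y = R̃_y + |X|` on `Y`; (iv) `∑_{x ∈ X} R_x = |X|(|X|+1)/2`. -/
theorem stmt15 {A : Type*} [Fintype A] [DecidableEq A] (v : A → A → ℝ)
    (hv : Llull v) (X Y : Finset A) (hX : X.Nonempty) (hY : Y.Nonempty)
    (hdisj : Disjoint X Y) (hcover : X ∪ Y = Finset.univ)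
    (ξ : A → A → Prop) (hξ : StrictTotal ξ) (hadm : Adm v ξ)
    (ξX : ↥X → ↥X → Prop) (hξX : StrictTotal ξX)
    (hadmX : Adm (fun a b : ↥X => v a b) ξX)
    (ξY : ↥Y → ↥Y → Prop) (hξY : StrictTotal ξY)
    (hadmY : Adm (fun a b : ↥Y => v a b) ξY) :
    ((∀ x ∈ X, ∀ y ∈ Y, v x y = 1) ↔
      (∀ x : ↥X, rlr v ξ ↑x = rlr (fun a b : ↥X => v a b) ξX x)) ∧
    ((∀ x ∈ X, ∀ y ∈ Y, v x y = 1) ↔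
      (∀ y : ↥Y, rlr v ξ ↑y = rlr (fun a b : ↥Y => v a b) ξY y + (X.card : ℝ))) ∧
    ((∀ x ∈ X, ∀ y ∈ Y, v x y = 1) ↔
      (∑ x ∈ X, rlr v ξ x = (X.card : ℝ) * ((X.card : ℝ) + 1) / 2)) := by
  have hmemY (z : A) : z ∈ Y ↔ z ∉ (X : Set A) := by
    have hz : z ∈ X ∪ Y := hcover ▸ Finset.mem_univ z
    rw [Finset.mem_union] at hz
    exact ⟨fun h h' => Finset.disjoint_left.1 hdisj h' h, fun h => hz.resolve_left h⟩
  have hYX : (Y : Set A) = (X : Set A)ᶜ := Set.ext hmemY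
  have hcut (h : ∀ x ∈ X, ∀ y ∈ Y, v x y = 1) :
      ∀ a ∈ (X : Set A), ∀ b ∉ (X : Set A), v a b = 1 :=
    fun a ha b hb => h a ha b ((hmemY b).2 hb)
  have hone (h : ∀ x ∈ X, ∀ y ∈ Y, v x y = 1) {x y : A} (hx : x ∈ X) (hy : y ∈ Y) :
      mpi v ξ x y = 1 := mpi_of_cut hv hξ hadm (hcut h) hx ((hmemY y).1 hy)
  have hii (h : ∀ x ∈ X, ∀ y ∈ Y, v x y = 1) (x : ↥X) :
      rlr v ξ ↑x = rlr (fun a b : ↥X => v a b) ξX x := by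
    have hsum : ∑ y ∈ Y, vpi v ξ x y = Y.card := by
      rw [Finset.sum_congr rfl fun y hy => by rw [vpi, hone h x.2 hy]]
      simp
    rw [rlr_restrict_eq hv hξ hadm (hcut h) (Or.inl rfl) hξX hadmX,
      rlr_eq_of_partition hξ hdisj hcover, hsum]
    ring
  have hiii (h : ∀ x ∈ X, ∀ y ∈ Y, v x y = 1) (y : ↥Y) :
      rlr v ξ ↑y = rlr (fun a b : ↥Y => v a b) ξY y + (X.card : ℝ) := by
    have hsum : ∑ x ∈ X, vpi v ξ y x = 0 :=
      Finset.sum_eq_zero fun x hx => by rw [vpi, mpi_antisymm hξ, hone h hx y.2]; norm_num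
    rw [rlr_restrict_eq hv hξ hadm (hcut h) (Or.inr hYX) hξY hadmY,
      rlr_eq_of_partition hξ hdisj hcover, hsum]
    ring
  have hii_iv (h : ∀ x : ↥X, rlr v ξ ↑x = rlr (fun a b : ↥X => v a b) ξX x) :
      ∑ x ∈ X, rlr v ξ x = (X.card : ℝ) * ((X.card : ℝ) + 1) / 2 := by
    rw [← Finset.sum_coe_sort, Finset.sum_congr rfl fun x _ => h x, sum_rlr hξX, Fintype.card_coe]
  have hiii_iv (h : ∀ y : ↥Y, rlr v ξ ↑y = rlr (fun a b : ↥Y => v a b) ξY y + (X.card : ℝ)) :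
      ∑ x ∈ X, rlr v ξ x = (X.card : ℝ) * ((X.card : ℝ) + 1) / 2 := by
    have hYsum : ∑ y ∈ Y, rlr v ξ y
        = (Y.card : ℝ) * (Y.card + 1) / 2 + Y.card * X.card := by
      rw [← Finset.sum_coe_sort, Finset.sum_congr rfl fun y _ => h y, Finset.sum_add_distrib,
        sum_rlr hξY, Fintype.card_coe]
      simp
    have htotal := sum_rlr (v := v) hξ
    rw [← hcover, Finset.sum_union hdisj, ← Finset.card_univ, ← hcover,
      Finset.card_union_of_disjoint hdisj, hYsum] at htotal
    push_cast at htotal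
    linarith
  have hiv_i := eq_one_of_sum_rlr hv hξ hadm hdisj hcover
  exact ⟨⟨hii, fun h => hiv_i (hii_iv h)⟩, ⟨hiii, fun h => hiv_i (hiii_iv h)⟩,
    ⟨fun h => hii_iv (hii h), hiv_i⟩⟩
end

section
/- Let v be a valued relation on a finite set A and let C ⊊ A be an autonomous set for v, i.e. v_{ax} = v_{bx} and v_{xa} = v_{xb} for all a, b ∈ C and x ∉ C. Then C is autonomous also for the indirect scores v*: v*_{ax} = v*_{bx} and v*_{xa} = v*_{xb} for all a, b ∈ C and x ∉ C. -/
/-! Common definitions: valued relations, indirect scores, admissible orders,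
projected margins/scores, rank-like rates (Camps–Mora–Saumell CLC method). -/

variable {A : Type*} [Fintype A] [DecidableEq A]

theorem linkScore_cons_cons_append {α : Type*} (v : α → α → ℝ) (a b y : α) (l : List α) :
    linkScore v (a :: b :: (l ++ [y])) = min (v a b) (linkScore v (b :: (l ++ [y]))) := by
  cases l <;> rfl

theorem linkScore_le_one {α : Type*} {v : α → α → ℝ} (hv : ∀ x y : α, x ≠ y → v x y ≤ 1) (y : α)
    (l : List α) (x : α) (h : List.IsChain (· ≠ ·) (x :: (l ++ [y]))) :
    linkScore v (x :: (l ++ [y])) ≤ 1 := by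
  cases l with
  | nil =>
    have h' : x ≠ y := by simpa using h
    exact hv x y h'
  | cons c l =>
    rw [List.cons_append, List.isChain_cons_cons] at h
    rw [List.cons_append, linkScore_cons_cons_append]
    exact (min_le_left _ _).trans (hv x c h.1)

/-- If every path from `x` to `y` is matched by a path from `x'` to `y'` with at least the same
score, then the indirect score of `(x, y)` is at most that of `(x', y')`. -/
theorem istar_le_istar {α : Type*} {v : α → α → ℝ} (hv : ∀ x y : α, x ≠ y → v x y ≤ 1) {x y x' y' : α}
    (hxy : x ≠ y)
    (h : ∀ l : List α, List.IsChain (· ≠ ·) (x :: (l ++ [y])) →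
      ∃ l' : List α, List.IsChain (· ≠ ·) (x' :: (l' ++ [y'])) ∧
        linkScore v (x :: (l ++ [y])) ≤ linkScore v (x' :: (l' ++ [y']))) :
    istar v x y ≤ istar v x' y' := by
  refine csSup_le ⟨_, [], List.isChain_pair.2 hxy, rfl⟩ ?_
  rintro s ⟨l, hl, rfl⟩
  obtain ⟨l', hl', hle⟩ := h l hl
  refine hle.trans (le_csSup ⟨1, ?_⟩ ⟨l', hl', rfl⟩)
  rintro t ⟨m, hm, rfl⟩
  exact linkScore_le_one hv y' m x' hm

/-- α path leaving an autonomous set can be restarted from any element of that set without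
decreasing its score. -/
theorem exists_path_change_start {α : Type*} {v : α → α → ℝ} {C : Set α}
    (haut : ∀ a ∈ C, ∀ b ∈ C, ∀ x ∉ C, v a x = v b x) {b x : α} (hb : b ∈ C) (hx : x ∉ C)
    (l : List α) (a : α) (ha : a ∈ C) (hl : List.IsChain (· ≠ ·) (a :: (l ++ [x]))) :
    ∃ l' : List α, List.IsChain (· ≠ ·) (b :: (l' ++ [x])) ∧
      linkScore v (a :: (l ++ [x])) ≤ linkScore v (b :: (l' ++ [x])) := by
  induction l generalizing a with
  | nil => exact ⟨[], by simpa using ne_of_mem_of_not_mem hb hx, (haut a ha b hb x hx).le⟩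
  | cons c l ih =>
    rw [List.cons_append, List.isChain_cons_cons] at hl
    rw [List.cons_append, linkScore_cons_cons_append]
    by_cases hc : c ∈ C
    · obtain ⟨l', hl', hle⟩ := ih c hc hl.2
      exact ⟨l', hl', (min_le_right _ _).trans hle⟩
    · refine ⟨c :: l, ?_, ?_⟩
      · rw [List.cons_append, List.isChain_cons_cons]
        exact ⟨ne_of_mem_of_not_mem hb hc, hl.2⟩
      · rw [List.cons_append, linkScore_cons_cons_append, haut a ha b hb c hc]

/-- α path entering an autonomous set can be redirected to any element of that set without
decreasing its score. -/
theorem exists_path_change_end {α : Type*} {v : α → α → ℝ} {C : Set α}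
    (haut : ∀ a ∈ C, ∀ b ∈ C, ∀ x ∉ C, v x a = v x b) {a b : α} (ha : a ∈ C) (hb : b ∈ C)
    (l : List α) (x : α) (hx : x ∉ C) (hl : List.IsChain (· ≠ ·) (x :: (l ++ [a]))) :
    ∃ l' : List α, List.IsChain (· ≠ ·) (x :: (l' ++ [b])) ∧
      linkScore v (x :: (l ++ [a])) ≤ linkScore v (x :: (l' ++ [b])) := by
  induction l generalizing x with
  | nil => exact ⟨[], by simpa using (ne_of_mem_of_not_mem hb hx).symm, (haut a ha b hb x hx).le⟩
  | cons c l ih =>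
    rw [List.cons_append, List.isChain_cons_cons] at hl
    rw [List.cons_append, linkScore_cons_cons_append]
    by_cases hc : c ∈ C
    · exact ⟨[], by simpa using (ne_of_mem_of_not_mem hb hx).symm,
        (min_le_left _ _).trans (haut c hc b hb x hx).le⟩
    · obtain ⟨l', hl', hle⟩ := ih c hc hl.2
      refine ⟨c :: l', ?_, ?_⟩
      · rw [List.cons_append, List.isChain_cons_cons]
        exact ⟨hl.1, hl'⟩
      · rw [List.cons_append, linkScore_cons_cons_append]
        exact min_le_min_left _ hle

/-- If `C ⊊ A` is autonomous for a valued relation `v`, then `C`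
is autonomous for the indirect scores `v*`. -/
theorem stmt17 {A : Type*} [Fintype A] [DecidableEq A] (v : A → A → ℝ)
    (hv : ∀ x y : A, x ≠ y → 0 ≤ v x y ∧ v x y ≤ 1)
    (C : Set A) (hC : C ≠ Set.univ)
    (haut : ∀ a ∈ C, ∀ b ∈ C, ∀ x ∉ C, v a x = v b x ∧ v x a = v x b) :
    ∀ a ∈ C, ∀ b ∈ C, ∀ x ∉ C,
      istar v a x = istar v b x ∧ istar v x a = istar v x b := by
  have hv1 : ∀ x y : A, x ≠ y → v x y ≤ 1 := fun x y h => (hv x y h).2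
  have hout : ∀ a ∈ C, ∀ b ∈ C, ∀ x ∉ C, istar v a x ≤ istar v b x := fun a ha b hb x hx =>
    istar_le_istar hv1 (ne_of_mem_of_not_mem ha hx) fun l hl =>
      exists_path_change_start (fun a ha b hb x hx => (haut a ha b hb x hx).1) hb hx l a ha hl
  have hin : ∀ a ∈ C, ∀ b ∈ C, ∀ x ∉ C, istar v x a ≤ istar v x b := fun a ha b hb x hx =>
    istar_le_istar hv1 (ne_of_mem_of_not_mem ha hx).symm fun l hl =>
      exists_path_change_end (fun a ha b hb x hx => (haut a ha b hb x hx).2) ha hb l x hx hl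
  exact fun a ha b hb x hx =>
    ⟨(hout a ha b hb x hx).antisymm (hout b hb a ha x hx),
      (hin a ha b hb x hx).antisymm (hin b hb a ha x hx)⟩
end
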